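/- Let a, b be real constants with b ≥ 0 and a + b (D · JC)^2 > 0 on U. Then on U the identity Σ_{i,j=1}^{2N} ∂/∂u_i ( (1/√(a + b (D · JC)^2)) · √g · g^{ij} w_j ) = 0 holds. (Weighted divergence identity, Step B of the proof of Theorem 3.1.) -/

import Mathlib

open scoped RealInnerProductSpace BigOperators

/-- Partial derivative of `f` in the `i`-th coordinate direction. -/
noncomputable def pd {ι : Type*} [Fintype ι] [DecidableEq ι]
    {F : Type*} [NormedAddCommGroup F] [NormedSpace ℝ F]
    (i : ι) (f : EuclideanSpace ℝ ι → F) (u : EuclideanSpace ℝ ι) : F :=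
  fderiv ℝ f u (EuclideanSpace.single i 1)

/-- Euclidean dot product on `ℝ^m × ℝ^m ≅ ℝ^{2m}`. -/
noncomputable def dot {m : ℕ} (p q : EuclideanSpace ℝ (Fin m) × EuclideanSpace ℝ (Fin m)) : ℝ :=
  @inner ℝ _ _ p.1 q.1 + @inner ℝ _ _ p.2 q.2

/-- The complex structure `J(x, y) = (−y, x)` on `ℝ^m × ℝ^m ≅ ℂ^m`. -/
def Jmap {m : ℕ} (p : EuclideanSpace ℝ (Fin m) × EuclideanSpace ℝ (Fin m)) :
    EuclideanSpace ℝ (Fin m) × EuclideanSpace ℝ (Fin m) :=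
  (-p.2, p.1)

section PartialDerivatives

variable {ι : Type*} [Fintype ι] [DecidableEq ι]
  {F : Type*} [NormedAddCommGroup F] [InnerProductSpace ℝ F]

theorem pd_inner {f h : EuclideanSpace ℝ ι → F} {u : EuclideanSpace ℝ ι}
    (hf : DifferentiableAt ℝ f u) (hh : DifferentiableAt ℝ h u) (i : ι) :
    pd i (fun v => ⟪f v, h v⟫) u = ⟪f u, pd i h u⟫ + ⟪pd i f u, h u⟫ := by
  unfold pd
  exact fderiv_inner_apply ℝ hf hh _

theorem pd_mul {f h : EuclideanSpace ℝ ι → ℝ} {u : EuclideanSpace ℝ ι}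
    (hf : DifferentiableAt ℝ f u) (hh : DifferentiableAt ℝ h u) (i : ι) :
    pd i (fun v => f v * h v) u = f u * pd i h u + pd i f u * h u := by
  simp only [pd, fderiv_fun_mul hf hh]
  simp [mul_comm]

theorem pd_sum {κ : Type*} {s : Finset κ} {f : κ → EuclideanSpace ℝ ι → ℝ}
    {u : EuclideanSpace ℝ ι} (hf : ∀ k ∈ s, DifferentiableAt ℝ (f k) u) (i : ι) :
    pd i (fun v => ∑ k ∈ s, f k v) u = ∑ k ∈ s, pd i (f k) u := by
  simp only [pd, fderiv_fun_sum hf]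
  simp

theorem pd_comp {f : EuclideanSpace ℝ ι → ℝ} {φ : ℝ → ℝ} {u : EuclideanSpace ℝ ι}
    (hφ : DifferentiableAt ℝ φ (f u)) (hf : DifferentiableAt ℝ f u) (i : ι) :
    pd i (fun v => φ (f v)) u = deriv φ (f u) * pd i f u := by
  have h := hφ.hasDerivAt.comp_hasFDerivAt u hf.hasFDerivAt
  simp only [pd]
  rw [show (fun v => φ (f v)) = φ ∘ f from rfl, h.fderiv]
  simp

theorem pd_clm_comp {F' : Type*} [NormedAddCommGroup F'] [NormedSpace ℝ F'] (L : F →L[ℝ] F')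
    {f : EuclideanSpace ℝ ι → F} {u : EuclideanSpace ℝ ι}
    (hf : DifferentiableAt ℝ f u) (i : ι) :
    pd i (fun v => L (f v)) u = L (pd i f u) := by
  have h := L.hasFDerivAt.comp u hf.hasFDerivAt
  simp only [pd]
  rw [show (fun v => L (f v)) = L ∘ f from rfl, h.fderiv]
  simp

theorem contDiff_pd {f : EuclideanSpace ℝ ι → F} (hf : ContDiff ℝ (⊤ : ℕ∞) f) (i : ι) :
    ContDiff ℝ (⊤ : ℕ∞) (pd i f) := by
  unfold pd
  exact (hf.fderiv_right (m := (⊤ : ℕ∞)) (by simp)).clm_apply contDiff_const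

theorem pd_pd_comm {f : EuclideanSpace ℝ ι → F} (hf : ContDiff ℝ (⊤ : ℕ∞) f) (i j : ι)
    (u : EuclideanSpace ℝ ι) : pd i (pd j f) u = pd j (pd i f) u := by
  have hd : DifferentiableAt ℝ (fderiv ℝ f) u :=
    (hf.fderiv_right (m := (⊤ : ℕ∞)) (by simp)).differentiable (by simp) u
  have key : ∀ i j : ι, pd i (pd j f) u
      = fderiv ℝ (fderiv ℝ f) u (EuclideanSpace.single i 1) (EuclideanSpace.single j 1) := by
    intro i j
    simp only [pd]
    rw [show (pd j f) = fun v => fderiv ℝ f v (EuclideanSpace.single j 1) from rfl,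
      fderiv_clm_apply hd (differentiableAt_const _)]
    simp
  rw [key, key]
  exact hf.contDiffAt.isSymmSndFDerivAt
    (by rw [minSmoothness_of_isRCLikeNormedField]; exact WithTop.coe_le_coe.2 le_top) _ _

/-- A map that does not change along the `i`-th coordinate has zero `i`-th partial derivative. -/
theorem pd_eq_zero_of_forall_add_smul {f : EuclideanSpace ℝ ι → F} {u : EuclideanSpace ℝ ι}
    {i : ι} (hf : DifferentiableAt ℝ f u)
    (h : ∀ t : ℝ, f (u + t • EuclideanSpace.single i 1) = f u) : pd i f u = 0 := by
  rw [pd, ← hf.lineDeriv_eq_fderiv]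
  simp [lineDeriv, h]

theorem differentiableAt_det {M : EuclideanSpace ℝ ι → Matrix ι ι ℝ} {u : EuclideanSpace ℝ ι}
    (hM : ∀ i j, DifferentiableAt ℝ (fun v => M v i j) u) :
    DifferentiableAt ℝ (fun v => (M v).det) u := by
  simp only [Matrix.det_apply]
  fun_prop

theorem differentiableAt_inv_apply {M : EuclideanSpace ℝ ι → Matrix ι ι ℝ}
    {u : EuclideanSpace ℝ ι} (hM : ∀ i j, DifferentiableAt ℝ (fun v => M v i j) u)
    (hdet : (M u).det ≠ 0) (i j : ι) : DifferentiableAt ℝ (fun v => (M v)⁻¹ i j) u := by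
  simp only [Matrix.inv_def, Ring.inverse_eq_inv', Matrix.smul_apply, smul_eq_mul,
    Matrix.adjugate_apply]
  refine ((differentiableAt_det hM).inv hdet).mul (differentiableAt_det fun a b => ?_)
  by_cases h : a = j
  · subst h
    simp
  · simpa [Matrix.updateRow_apply, h] using hM a b

/-- Jacobi's formula for the partial derivatives of a determinant. -/
theorem pd_det {M : EuclideanSpace ℝ ι → Matrix ι ι ℝ} {u : EuclideanSpace ℝ ι}
    (hM : ∀ i j, DifferentiableAt ℝ (fun v => M v i j) u) (k : ι) :
    pd k (fun v => (M v).det) u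
      = ∑ i, ∑ j, (M u).adjugate i j * pd k (fun v => M v j i) u := by
  have hrhs : ∀ i, ∑ j, (M u).adjugate i j * pd k (fun v => M v j i) u
      = ((M u).updateCol i fun j => pd k (fun v => M v j i) u).det := by
    intro i
    rw [← Matrix.cramer_apply, Matrix.cramer_eq_adjugate_mulVec]
    rfl
  simp only [hrhs, Matrix.det_apply']
  rw [pd_sum (fun σ _ => by fun_prop), Finset.sum_comm]
  refine Finset.sum_congr rfl fun σ _ => ?_
  rw [pd_mul (by fun_prop) (by fun_prop)]
  have hprod : pd k (fun v => ∏ i, M v (σ i) i) u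
      = ∑ i, (∏ j ∈ Finset.univ.erase i, M u (σ j) j) * pd k (fun v => M v (σ i) i) u := by
    simp only [pd]
    rw [fderiv_finsetProd (fun i _ => hM (σ i) i)]
    simp
  rw [hprod, Finset.mul_sum]
  simp only [pd, fderiv_fun_const, Pi.zero_apply, zero_apply, zero_mul, add_zero]
  refine Finset.sum_congr rfl fun i _ => ?_
  congr 1
  rw [← Finset.prod_erase_mul _ _ (Finset.mem_univ i), Matrix.updateCol_self]
  congr 1
  refine Finset.prod_congr rfl fun j hj => ?_
  rw [Matrix.updateCol_ne (Finset.ne_of_mem_erase hj)]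

theorem pd_sqrt_det {M : EuclideanSpace ℝ ι → Matrix ι ι ℝ} {u : EuclideanSpace ℝ ι}
    (hM : ∀ i j, DifferentiableAt ℝ (fun v => M v i j) u) (hdet : (M u).det ≠ 0) (k : ι) :
    pd k (fun v => √(M v).det) u
      = √(M u).det * (1 / 2 * ∑ i, ∑ j, (M u)⁻¹ i j * pd k (fun v => M v j i) u) := by
  rw [pd_comp (φ := Real.sqrt) (Real.hasDerivAt_sqrt hdet).differentiableAt
    (differentiableAt_det hM), (Real.hasDerivAt_sqrt hdet).deriv, pd_det hM]
  simp only [Matrix.inv_def, Ring.inverse_eq_inv', Matrix.smul_apply, smul_eq_mul, mul_assoc,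
    ← Finset.mul_sum]
  nth_rw 2 [← Real.div_sqrt]
  field_simp

/-- Coordinate formula for the divergence of the tangential projection `∑ V k • pd k c` of a
vector field `P` along the immersion `c`. -/
theorem sum_pd_sqrt_det_mul {c P : EuclideanSpace ℝ ι → F} (hc : ContDiff ℝ (⊤ : ℕ∞) c)
    {u : EuclideanSpace ℝ ι} (hP : DifferentiableAt ℝ P u)
    {G : EuclideanSpace ℝ ι → Matrix ι ι ℝ} (hG : ∀ v i j, G v i j = ⟪pd i c v, pd j c v⟫)
    (hdet : (G u).det ≠ 0) {V : ι → EuclideanSpace ℝ ι → ℝ}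
    (hV : ∀ i, DifferentiableAt ℝ (V i) u)
    (hGV : ∀ᶠ v in nhds u, ∀ a, ∑ b, G v a b * V b v = ⟪pd a c v, P v⟫) :
    ∑ i, pd i (fun v => √(G v).det * V i v) u
      = √(G u).det * ∑ i, ∑ a, (G u)⁻¹ i a *
          (⟪pd a c u, pd i P u⟫ + ⟪pd i (pd a c) u, P u - ∑ k, V k u • pd k c u⟫) := by
  have hp : ∀ a, DifferentiableAt ℝ (pd a c) u := fun a =>
    (contDiff_pd hc a).differentiable (by simp) u
  have hGd : ∀ a b, DifferentiableAt ℝ (fun v => G v a b) u := fun a b => by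
    simp only [hG]
    exact (hp a).inner ℝ (hp b)
  have hsymm : ∀ a b, (G u)⁻¹ a b = (G u)⁻¹ b a := fun a b => by
    have : (G u).IsSymm := Matrix.IsSymm.ext fun i j => by rw [hG, hG, real_inner_comm]
    exact this.inv.apply b a
  have hpdG : ∀ i a b, pd i (fun v => G v a b) u
      = ⟪pd a c u, pd i (pd b c) u⟫ + ⟪pd i (pd a c) u, pd b c u⟫ := fun i a b => by
    simp only [hG]
    exact pd_inner (hp a) (hp b) i
  have hsqrt : DifferentiableAt ℝ (fun v => √(G v).det) u := (differentiableAt_det hGd).sqrt hdet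
  have hpdV : ∀ i a, ∑ b, G u a b * pd i (V b) u
      = ⟪pd a c u, pd i P u⟫ + ⟪pd i (pd a c) u, P u⟫
        - ∑ b, pd i (fun v => G v a b) u * V b u := fun i a => by
    have h1 : pd i (fun v => ∑ b, G v a b * V b v) u = pd i (fun v => ⟪pd a c v, P v⟫) u := by
      unfold pd
      rw [Filter.EventuallyEq.fderiv_eq (hGV.mono fun v hv => hv a)]
      rfl
    rw [pd_inner (hp a) hP, pd_sum (fun b _ => (hGd a b).fun_mul (hV b))] at h1
    rw [← h1, eq_sub_iff_add_eq, ← Finset.sum_add_distrib]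
    exact Finset.sum_congr rfl fun b _ => (pd_mul (hGd a b) (hV b) i).symm
  have hpdV' : ∀ i, pd i (V i) u = ∑ a, (G u)⁻¹ i a *
      (⟪pd a c u, pd i P u⟫ + ⟪pd i (pd a c) u, P u⟫
        - ∑ b, pd i (fun v => G v a b) u * V b u) := fun i => by
    have h2 : (G u)⁻¹.mulVec ((G u).mulVec fun b => pd i (V b) u) = fun b => pd i (V b) u := by
      rw [Matrix.mulVec_mulVec, Matrix.nonsing_inv_mul _ (isUnit_iff_ne_zero.2 hdet),
        Matrix.one_mulVec]
    have h3 := congrFun h2 i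
    simp only [Matrix.mulVec, dotProduct, hpdV] at h3
    exact h3.symm
  have htr : ∀ i, 1 / 2 * ∑ a, ∑ b, (G u)⁻¹ a b * pd i (fun v => G v b a) u
      = ∑ a, ∑ b, (G u)⁻¹ a b * ⟪pd b c u, pd i (pd a c) u⟫ := fun i => by
    simp only [hpdG, mul_add, Finset.sum_add_distrib]
    have : ∑ a, ∑ b, (G u)⁻¹ a b * ⟪pd i (pd b c) u, pd a c u⟫
        = ∑ a, ∑ b, (G u)⁻¹ a b * ⟪pd b c u, pd i (pd a c) u⟫ := by
      rw [Finset.sum_comm]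
      refine Finset.sum_congr rfl fun a _ => Finset.sum_congr rfl fun b _ => ?_
      rw [hsymm, real_inner_comm]
    rw [this]
    ring
  have hcross : ∑ i, (∑ a, ∑ b, (G u)⁻¹ a b * ⟪pd b c u, pd i (pd a c) u⟫) * V i u
      = ∑ i, ∑ a, (G u)⁻¹ i a * ∑ b, ⟪pd a c u, pd i (pd b c) u⟫ * V b u := by
    simp only [Finset.sum_mul, Finset.mul_sum]
    rw [Finset.sum_comm]
    refine Finset.sum_congr rfl fun a _ => ?_
    rw [Finset.sum_comm]
    refine Finset.sum_congr rfl fun b _ => Finset.sum_congr rfl fun i _ => ?_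
    rw [pd_pd_comm hc i a]
    ring
  have hterm : ∀ i, pd i (fun v => √(G v).det * V i v) u
      = √(G u).det * (pd i (V i) u
        + (∑ a, ∑ b, (G u)⁻¹ a b * ⟪pd b c u, pd i (pd a c) u⟫) * V i u) := fun i => by
    rw [pd_mul hsqrt (hV i), pd_sqrt_det hGd hdet, htr]
    ring
  simp only [hterm, ← Finset.mul_sum, Finset.sum_add_distrib, hcross, hpdV', hpdG]
  congr 1
  simp only [← Finset.sum_add_distrib]
  refine Finset.sum_congr rfl fun i _ => Finset.sum_congr rfl fun a _ => ?_
  simp only [inner_sub_right, inner_sum, inner_smul_right, add_mul, Finset.sum_add_distrib]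
  simp only [mul_comm (V _ u)]
  ring

theorem eq_zero_of_det_gram_ne_zero {κ : Type*} [Fintype κ] [DecidableEq κ] [Nonempty κ]
    {b : κ → F} (hdet : (Matrix.gram ℝ b).det ≠ 0) (hcard : Fintype.card κ = Module.finrank ℝ F)
    {x : F} (hx : ∀ k, ⟪b k, x⟫ = 0) : x = 0 := by
  have hspan := (Matrix.linearIndependent_of_det_gram_ne_zero hdet).span_eq_top_of_card_eq_finrank
    hcard
  have hmem : x ∈ (Submodule.span ℝ (Set.range b))ᗮ := by
    rw [Submodule.mem_orthogonal]
    intro y hy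
    induction hy using Submodule.span_induction with
    | mem y hy => obtain ⟨k, rfl⟩ := hy; exact hx k
    | zero => simp
    | add y z _ _ hy hz => rw [inner_add_left, hy, hz, add_zero]
    | smul r y _ hy => rw [inner_smul_left, hy, mul_zero]
  rwa [hspan, Submodule.top_orthogonal_eq_bot, Submodule.mem_bot] at hmem

/-- Tangential–normal decomposition along a family of tangent vectors `p` with two orthonormal
normal vectors `c`, `d`. -/
theorem sum_inv_mulVec_smul_eq {p : ι → F} {c d x : F} {G : Matrix ι ι ℝ}
    (hG : ∀ i j, G i j = ⟪p i, p j⟫) (hdet : G.det ≠ 0)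
    (hdim : Module.finrank ℝ F = Fintype.card ι + 2)
    (hcc : ‖c‖ = 1) (hdd : ‖d‖ = 1) (hcd : ⟪c, d⟫ = 0)
    (hpc : ∀ i, ⟪p i, c⟫ = 0) (hpd : ∀ i, ⟪p i, d⟫ = 0) (hcx : ⟪c, x⟫ = 0) :
    ∑ i, (G⁻¹.mulVec fun j => ⟪p j, x⟫) i • p i = x - ⟪d, x⟫ • d := by
  have hcp : ∀ i, ⟪c, p i⟫ = 0 := fun i => by rw [real_inner_comm, hpc]
  have hdp : ∀ i, ⟪d, p i⟫ = 0 := fun i => by rw [real_inner_comm, hpd]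
  have hgram : Matrix.gram ℝ (Sum.elim p ![c, d]) = Matrix.fromBlocks G 0 0 1 := by
    ext (i | i) (j | j)
    · simp [Matrix.gram_apply, hG]
    · fin_cases j <;> simp [Matrix.gram_apply, hpc, hpd]
    · fin_cases i <;> simp [Matrix.gram_apply, hcp, hdp]
    · fin_cases i <;> fin_cases j <;>
        simp [Matrix.gram_apply, hcc, hdd, hcd, real_inner_comm c d]
  symm
  rw [← sub_eq_zero]
  refine eq_zero_of_det_gram_ne_zero (b := Sum.elim p ![c, d]) (by simpa [hgram] using hdet)
    (by simp [hdim]) ?_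
  rintro (a | a)
  · have h : G.mulVec (G⁻¹.mulVec fun j => ⟪p j, x⟫) a = ⟪p a, x⟫ := by
      rw [Matrix.mulVec_mulVec, Matrix.mul_nonsing_inv _ (isUnit_iff_ne_zero.2 hdet),
        Matrix.one_mulVec]
    rw [Matrix.mulVec, dotProduct] at h
    simp only [Sum.elim_inl, inner_sub_right, inner_smul_right, inner_sum, hpd, ← hG]
    simp only [mul_comm _ (G a _), h]
    simp
  · fin_cases a
    · simp [inner_sub_right, inner_smul_right, inner_sum, hcp, hcx, hcd]
    · simp [inner_sub_right, inner_smul_right, inner_sum, hdp, hdd]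

/-- Weighted divergence identity for a spherical immersion `c` of codimension two whose normal
`E c` is the image of `c` under an isometric involution `E` anticommuting with `J`, with respect
to which the coordinate tangent vectors are eigenvectors of total trace zero. -/
theorem sum_pd_weight_mul_eq_zero {J E : F →L[ℝ] F}
    (hJ : ∀ x y, ⟪J x, y⟫ = -⟪x, J y⟫) (hJJ : ∀ x, J (J x) = -x)
    (hE : ∀ x y, ⟪E x, y⟫ = ⟪x, E y⟫) (hEE : ∀ x, E (E x) = x)
    (hEJ : ∀ x, E (J x) = -J (E x))
    (hdim : Module.finrank ℝ F = Fintype.card ι + 2)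
    {c : EuclideanSpace ℝ ι → F} (hc : ContDiff ℝ (⊤ : ℕ∞) c)
    (hnorm : ∀ v, ‖c v‖ = 1) (hcE : ∀ v, ⟪c v, E (c v)⟫ = 0)
    {ε : ι → ℝ} (hε : ∀ i v, E (pd i c v) = ε i • pd i c v) (hε0 : ∑ i, ε i = 0)
    {G : EuclideanSpace ℝ ι → Matrix ι ι ℝ} (hG : ∀ v i j, G v i j = ⟪pd i c v, pd j c v⟫)
    {u : EuclideanSpace ℝ ι} (hdet : (G u).det ≠ 0)
    {h : ℝ → ℝ} (hh : DifferentiableAt ℝ h ⟪E (c u), J (c u)⟫) :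
    ∑ i, ∑ j, pd i (fun v => h ⟪E (c v), J (c v)⟫ *
      (√(G v).det * (G v)⁻¹ i j * ⟪pd j c v, J (c v)⟫)) u = 0 := by
  have hcc : ∀ v, ⟪c v, c v⟫ = 1 := fun v => by rw [real_inner_self_eq_norm_sq, hnorm, one_pow]
  have hcd : Differentiable ℝ c := hc.differentiable (by simp)
  have hp : ∀ a, Differentiable ℝ (pd a c) := fun a => (contDiff_pd hc a).differentiable (by simp)
  have hJc : ∀ v, DifferentiableAt ℝ (fun v => J (c v)) v := fun v =>
    J.differentiableAt.comp v (hcd v)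
  have hEc : ∀ v, DifferentiableAt ℝ (fun v => E (c v)) v := fun v =>
    E.differentiableAt.comp v (hcd v)
  have hGd : ∀ a b v, DifferentiableAt ℝ (fun v => G v a b) v := fun a b v => by
    simp only [hG]
    exact (hp a v).inner ℝ (hp b v)
  have hJself : ∀ x, ⟪x, J x⟫ = 0 := fun x => by
    have := hJ x x
    rw [real_inner_comm] at this
    linarith
  have hpc : ∀ i v, ⟪pd i c v, c v⟫ = 0 := fun i v => by
    have h1 := pd_inner (hcd v) (hcd v) i
    simp only [hcc] at h1
    rw [real_inner_comm] at h1
    simp only [pd, fderiv_fun_const, Pi.zero_apply, zero_apply] at h1 ⊢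
    linarith
  have hpn : ∀ i v, ⟪pd i c v, E (c v)⟫ = 0 := fun i v => by
    have h1 := pd_inner (hcd v) (hEc v) i
    simp only [hcE] at h1
    rw [pd_clm_comp E (hcd v), ← hE, real_inner_comm] at h1
    simp only [pd, fderiv_fun_const, Pi.zero_apply, zero_apply] at h1 ⊢
    linarith
  have hEnorm : ‖E (c u)‖ = 1 := by
    rw [← sq_eq_sq₀ (norm_nonneg _) zero_le_one, ← real_inner_self_eq_norm_sq, hE, hEE, hcc,
      one_pow]
  set w : EuclideanSpace ℝ ι → ι → ℝ := fun v j => ⟪pd j c v, J (c v)⟫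
  set V : ι → EuclideanSpace ℝ ι → ℝ := fun i v => (G v)⁻¹.mulVec (w v) i with hV
  set s : EuclideanSpace ℝ ι → ℝ := fun v => ⟪E (c v), J (c v)⟫ with hs
  have hwd : ∀ j, DifferentiableAt ℝ (fun v => w v j) u := fun j => (hp j u).inner ℝ (hJc u)
  have hinv := differentiableAt_inv_apply (fun a b => hGd a b u) hdet
  have hVd : ∀ i, DifferentiableAt ℝ (V i) u := fun i => by
    simp only [hV, Matrix.mulVec, dotProduct]
    exact DifferentiableAt.fun_sum fun j _ => (hinv i j).fun_mul (hwd j)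
  have hsd : DifferentiableAt ℝ s u := (hEc u).inner ℝ (hJc u)
  have hsqrt : DifferentiableAt ℝ (fun v => √(G v).det) u :=
    (differentiableAt_det fun a b => hGd a b u).sqrt hdet
  have hproj : ∑ k, V k u • pd k c u = J (c u) - s u • E (c u) :=
    sum_inv_mulVec_smul_eq (hG u) hdet hdim (hnorm u) hEnorm (hcE u) (fun i => hpc i u)
      (fun i => hpn i u) (hJself _)
  have hGV : ∀ᶠ v in nhds u, ∀ a, ∑ b, G v a b * V b v = ⟪pd a c v, J (c v)⟫ := by
    filter_upwards [(differentiableAt_det fun a b => hGd a b u).continuousAt.eventually_ne hdet]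
      with v hv a
    have h1 : (G v).mulVec ((G v)⁻¹.mulVec (w v)) a = w v a := by
      rw [Matrix.mulVec_mulVec, Matrix.mul_nonsing_inv _ (isUnit_iff_ne_zero.2 hv),
        Matrix.one_mulVec]
    exact h1
  have hdiv : ∑ i, pd i (fun v => √(G v).det * V i v) u = 0 := by
    rw [sum_pd_sqrt_det_mul hc (hJc u) hG hdet hVd hGV, hproj]
    have hsecond : ∀ i a, ⟪pd i (pd a c) u, E (c u)⟫ = -(ε i * G u a i) := fun i a => by
      have h1 := pd_inner (hp a u) (hEc u) i
      simp only [hpn] at h1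
      rw [pd_clm_comp E (hcd u), hε, inner_smul_right, ← hG] at h1
      simp only [pd, fderiv_fun_const, Pi.zero_apply, zero_apply] at h1 ⊢
      linarith
    have hsymm : ∀ a b, (G u)⁻¹ a b = (G u)⁻¹ b a := fun a b => by
      have : (G u).IsSymm := Matrix.IsSymm.ext fun i j => by rw [hG, hG, real_inner_comm]
      exact this.inv.apply b a
    have hanti : ∑ i, ∑ a, (G u)⁻¹ i a * ⟪pd a c u, J (pd i c u)⟫ = 0 := by
      have h1 : ∑ i, ∑ a, (G u)⁻¹ i a * ⟪pd a c u, J (pd i c u)⟫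
          = -∑ i, ∑ a, (G u)⁻¹ i a * ⟪pd a c u, J (pd i c u)⟫ := by
        conv_lhs => rw [Finset.sum_comm]
        simp only [← Finset.sum_neg_distrib]
        refine Finset.sum_congr rfl fun i _ => Finset.sum_congr rfl fun a _ => ?_
        rw [hsymm, real_inner_comm, hJ]
        ring
      linarith
    have htrace : ∑ i, ∑ a, (G u)⁻¹ i a * (ε i * G u a i) = 0 := by
      rw [← hε0]
      refine Finset.sum_congr rfl fun i _ => ?_
      have h1 : ((G u)⁻¹ * G u) i i = 1 := by
        rw [Matrix.nonsing_inv_mul _ (isUnit_iff_ne_zero.2 hdet), Matrix.one_apply_eq]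
      rw [Matrix.mul_apply] at h1
      simp only [mul_left_comm _ (ε i), ← Finset.mul_sum, h1, mul_one]
    simp only [pd_clm_comp J (hcd u), sub_sub_cancel, inner_smul_right, hsecond, mul_add,
      Finset.sum_add_distrib, hanti, mul_left_comm _ (s u), mul_neg, Finset.sum_neg_distrib,
      ← Finset.mul_sum, htrace]
    simp
  have hgrad : ∑ i, V i u * pd i s u = 0 := by
    have hpds : ∀ i, pd i s u = 2 * ⟪pd i c u, E (J (c u))⟫ := fun i => by
      rw [hs, pd_inner (hEc u) (hJc u), pd_clm_comp E (hcd u), pd_clm_comp J (hcd u), hE (pd i c u),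
        real_inner_comm, hJ, ← inner_neg_right, ← hEJ]
      ring
    have h1 : ⟪∑ k, V k u • pd k c u, E (J (c u))⟫ = 0 := by
      rw [hproj, inner_sub_left, inner_smul_left, hE (c u), hEE, hJself, hEJ, inner_neg_right, hJ,
        hJJ]
      simp [hcE]
    rw [sum_inner] at h1
    simp only [inner_smul_left, RCLike.conj_to_real] at h1
    simp only [hpds, mul_left_comm _ (2 : ℝ), ← Finset.mul_sum, h1, mul_zero]
  have hsum : ∀ i, ∑ j, pd i (fun v => h (s v) * (√(G v).det * (G v)⁻¹ i j * w v j)) u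
      = h (s u) * pd i (fun v => √(G v).det * V i v) u
        + deriv h (s u) * √(G u).det * (V i u * pd i s u) := fun i => by
    have hhs : DifferentiableAt ℝ (fun v => h (s v)) u := hh.comp u hsd
    have h1 := pd_sum (s := Finset.univ) (f := fun j v => h (s v) *
      (√(G v).det * (G v)⁻¹ i j * w v j)) (u := u)
      (fun j _ => hhs.fun_mul ((hsqrt.fun_mul (hinv i j)).fun_mul (hwd j))) i
    have h2 : (fun v => ∑ j, h (s v) * (√(G v).det * (G v)⁻¹ i j * w v j))
        = fun v => h (s v) * (√(G v).det * V i v) := by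
      funext v
      simp only [hV, Matrix.mulVec, dotProduct, Finset.mul_sum, mul_assoc]
    rw [← h1, h2, pd_mul hhs (hsqrt.fun_mul (hVd i)), pd_comp hh hsd]
    ring
  rw [Finset.sum_congr rfl fun i _ => hsum i, Finset.sum_add_distrib, ← Finset.mul_sum,
    ← Finset.mul_sum, hdiv, hgrad]
  simp

end PartialDerivatives

/-- Weighted divergence identity, Step B of the proof of Theorem 3.1. -/
theorem clifford_torus_weighted_divergence_identity (N : ℕ) (hN : 1 ≤ N)
    (X Y : EuclideanSpace ℝ (Fin (2 * N)) → EuclideanSpace ℝ (Fin (N + 1)))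
    (hX : ContDiff ℝ (⊤ : ℕ∞) X) (hY : ContDiff ℝ (⊤ : ℕ∞) Y)
    (hXdep : ∀ u u' : EuclideanSpace ℝ (Fin (2 * N)),
      (∀ i : Fin (2 * N), (i : ℕ) < N → u i = u' i) → X u = X u')
    (hYdep : ∀ u u' : EuclideanSpace ℝ (Fin (2 * N)),
      (∀ i : Fin (2 * N), N ≤ (i : ℕ) → u i = u' i) → Y u = Y u')
    (hXnorm : ∀ u, ‖X u‖ = 1) (hYnorm : ∀ u, ‖Y u‖ = 1)
    (C D : EuclideanSpace ℝ (Fin (2 * N)) →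
      EuclideanSpace ℝ (Fin (N + 1)) × EuclideanSpace ℝ (Fin (N + 1)))
    (hC : C = fun u => ((Real.sqrt 2)⁻¹ • X u, (Real.sqrt 2)⁻¹ • Y u))
    (hD : D = fun u => ((Real.sqrt 2)⁻¹ • X u, -((Real.sqrt 2)⁻¹ • Y u)))
    (g : EuclideanSpace ℝ (Fin (2 * N)) → Matrix (Fin (2 * N)) (Fin (2 * N)) ℝ)
    (hg : ∀ u i j, g u i j = dot (pd i C u) (pd j C u))
    (w : Fin (2 * N) → EuclideanSpace ℝ (Fin (2 * N)) → ℝ)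
    (hw : ∀ j u, w j u = dot (pd j C u) (Jmap (C u)))
    (U : Set (EuclideanSpace ℝ (Fin (2 * N)))) (hUopen : IsOpen U)
    (hginv : ∀ u ∈ U, IsUnit (g u).det)
    (a b : ℝ) (hb : 0 ≤ b)
    (hpos : ∀ u ∈ U, 0 < a + b * dot (D u) (Jmap (C u)) ^ 2) :
    ∀ u ∈ U,
      ∑ i, ∑ j, pd i (fun v =>
        (Real.sqrt (a + b * dot (D v) (Jmap (C v)) ^ 2))⁻¹ *
          (Real.sqrt (g v).det * (g v)⁻¹ i j * w j v)) u = 0 := by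
  intro u hu
  set e := WithLp.prodContinuousLinearEquiv 2 ℝ (EuclideanSpace ℝ (Fin (N + 1)))
    (EuclideanSpace ℝ (Fin (N + 1)))
  have hdot : ∀ p q, dot p q = ⟪e.symm p, e.symm q⟫ := fun p q => by
    rw [WithLp.prod_inner_apply]
    rfl
  have hXd : Differentiable ℝ X := hX.differentiable (by simp)
  have hYd : Differentiable ℝ Y := hY.differentiable (by simp)
  have hCs : ContDiff ℝ (⊤ : ℕ∞) C := by
    rw [hC]
    exact (hX.const_smul _).prodMk (hY.const_smul _)
  set c : EuclideanSpace ℝ (Fin (2 * N)) → _ := fun v => e.symm (C v) with hc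
  have hcs : ContDiff ℝ (⊤ : ℕ∞) c := e.symm.contDiff.comp hCs
  have hpdc : ∀ i v, pd i c v = e.symm (pd i C v) := fun i v => by
    unfold pd
    rw [hc, show (fun v => e.symm (C v)) = e.symm ∘ C from rfl, e.symm.comp_fderiv]
    rfl
  have hpdC : ∀ i v, pd i C v = ((√2)⁻¹ • pd i X v, (√2)⁻¹ • pd i Y v) := fun i v => by
    unfold pd
    rw [hC, DifferentiableAt.fderiv_prodMk ((hXd v).fun_const_smul _) ((hYd v).fun_const_smul _),
      fderiv_fun_const_smul (hXd v), fderiv_fun_const_smul (hYd v)]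
    rfl
  have hpdX : ∀ i : Fin (2 * N), N ≤ (i : ℕ) → ∀ v, pd i X v = 0 := fun i hi v =>
    pd_eq_zero_of_forall_add_smul (hXd v) fun t => hXdep _ _ fun j hj => by
      have : j ≠ i := fun h => by omega
      simp [this]
  have hpdY : ∀ i : Fin (2 * N), (i : ℕ) < N → ∀ v, pd i Y v = 0 := fun i hi v =>
    pd_eq_zero_of_forall_add_smul (hYd v) fun t => hYdep _ _ fun j hj => by
      have : j ≠ i := fun h => by omega
      simp [this]
  have hsq : (√2 : ℝ)⁻¹ * (√2)⁻¹ = 1 / 2 := by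
    rw [← mul_inv, Real.mul_self_sqrt zero_le_two, one_div]
  set fst' := ContinuousLinearMap.fst ℝ (EuclideanSpace ℝ (Fin (N + 1)))
    (EuclideanSpace ℝ (Fin (N + 1)))
  set snd' := ContinuousLinearMap.snd ℝ (EuclideanSpace ℝ (Fin (N + 1)))
    (EuclideanSpace ℝ (Fin (N + 1)))
  set J := (e.symm.toContinuousLinearMap.comp ((-snd').prod fst')).comp e.toContinuousLinearMap
  set E := (e.symm.toContinuousLinearMap.comp (fst'.prod (-snd'))).comp e.toContinuousLinearMap
  have hJe : ∀ p, J (e.symm p) = e.symm (Jmap p) := fun p => rfl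
  have hEe : ∀ p, E (e.symm p) = e.symm (p.1, -p.2) := fun p => rfl
  have hEc : ∀ v, E (c v) = e.symm (D v) := fun v => by
    rw [hc, hEe, hC, hD]
  have hJc : ∀ v, J (c v) = e.symm (Jmap (C v)) := fun v => hJe (C v)
  have hdet : (g u).det ≠ 0 := (hginv u hu).ne_zero
  have hG : ∀ v i j, g v i j = ⟪pd i c v, pd j c v⟫ := fun v i j => by
    rw [hg, hdot, hpdc, hpdc]
  have hsum : ∑ i : Fin (2 * N), (if (i : ℕ) < N then (1 : ℝ) else -1) = 0 := by
    rw [Fin.sum_univ_eq_sum_range (fun i => if i < N then (1 : ℝ) else -1), two_mul,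
      Finset.sum_range_add, Finset.sum_congr rfl fun i hi => if_pos (Finset.mem_range.1 hi)]
    simp
  have hh : DifferentiableAt ℝ (fun x : ℝ => (√(a + b * x ^ 2))⁻¹) ⟪E (c u), J (c u)⟫ := by
    have h0 := hpos u hu
    rw [hdot, ← hEc, ← hJe] at h0
    have h1 : DifferentiableAt ℝ (fun x : ℝ => a + b * x ^ 2) ⟪E (c u), J (c u)⟫ := by fun_prop
    exact (h1.sqrt h0.ne').fun_inv (Real.sqrt_pos.2 h0).ne'
  have hmain := sum_pd_weight_mul_eq_zero (J := J) (E := E) (c := c)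
    (ε := fun i => if (i : ℕ) < N then 1 else -1) (G := g) (u := u)
    (h := fun x => (√(a + b * x ^ 2))⁻¹) ?_ ?_ ?_ ?_ ?_ ?_ hcs ?_ ?_ ?_ hsum hG hdet hh
  · simpa only [hEc, hJc, hpdc, hw, hdot] using hmain
  · intro x y
    obtain ⟨p, rfl⟩ := e.symm.surjective x
    obtain ⟨q, rfl⟩ := e.symm.surjective y
    rw [hJe, hJe, ← hdot, ← hdot]
    simp [dot, Jmap]
  · intro x
    obtain ⟨p, rfl⟩ := e.symm.surjective x
    rw [hJe, hJe, ← map_neg]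
    rfl
  · intro x y
    obtain ⟨p, rfl⟩ := e.symm.surjective x
    obtain ⟨q, rfl⟩ := e.symm.surjective y
    rw [hEe, hEe, ← hdot, ← hdot]
    simp [dot]
  · intro x
    obtain ⟨p, rfl⟩ := e.symm.surjective x
    rw [hEe, hEe]
    simp
  · intro x
    obtain ⟨p, rfl⟩ := e.symm.surjective x
    rw [hJe, hEe, hEe, hJe, ← map_neg]
    simp [Jmap]
  · rw [e.toLinearEquiv.finrank_eq]
    simp
    ring
  · intro v
    rw [← sq_eq_sq₀ (norm_nonneg _) zero_le_one, ← real_inner_self_eq_norm_sq, hc, ← hdot, hC]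
    simp only [dot, inner_smul_left, inner_smul_right, real_inner_self_eq_norm_sq, hXnorm, hYnorm]
    simp only [RCLike.conj_to_real, one_pow, mul_one, hsq]
    norm_num
  · intro v
    rw [hEc, hc, ← hdot, hC, hD]
    simp only [dot, inner_neg_right, inner_smul_left, inner_smul_right,
      real_inner_self_eq_norm_sq, hXnorm, hYnorm]
    simp
  · intro i v
    rw [hpdc, hEe, hpdC, ← map_smul]
    split_ifs with hi
    · simp [hpdY i hi]
    · simp [hpdX i (not_lt.1 hi)]
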